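/- There exists a constant C > 0 such that for every n ≥ 3 and every stable tree T of the tree connection game with n agents, the height of T (the maximum length of a leaf-to-root path) is at most C · (log n / log log n). -/

import Mathlib

open Function
open scoped ENNReal Classical

noncomputable section

namespace TCG

variable {n : ℕ}

/-- In-degree of node `v` in the network induced by profile `s` with root `r`:
the number of activated edges `(u, v)` with `u` an agent (a non-root node). -/
def indeg (r : Fin (n + 1)) (s : Fin (n + 1) → Fin (n + 1)) (v : Fin (n + 1)) : ℕ :=
  Nat.card {u : Fin (n + 1) | u ≠ r ∧ s u = v}

/-- `|T(u)|`: the number of nodes having a directed path to `u` (including `u` itself). -/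
def subtreeSize (s : Fin (n + 1) → Fin (n + 1)) (u : Fin (n + 1)) : ℕ :=
  Nat.card {w : Fin (n + 1) | ∃ k, s^[k] w = u}

/-- Cost of the agent at node `v` with respect to the root `r`:
the sum, over the edges `(u, u')` of the unique directed path from `v` to `r`,
of `indeg(u') / |T(u)|`; the cost is `∞` if no such path exists. -/
def cost (r : Fin (n + 1)) (s : Fin (n + 1) → Fin (n + 1)) (v : Fin (n + 1)) : ℝ≥0∞ :=
  if h : ∃ k, s^[k] v = r then
    ∑ k ∈ Finset.range (Nat.find h),
      (indeg r s (s^[k + 1] v) : ℝ≥0∞) / (subtreeSize s (s^[k] v) : ℝ≥0∞)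
  else ⊤

/-- A valid strategy profile: the root is absorbing (a formal convention encoding that the
root activates no edge), and every agent chooses a node different from herself. -/
def ValidProfile (r : Fin (n + 1)) (s : Fin (n + 1) → Fin (n + 1)) : Prop :=
  s r = r ∧ ∀ v, v ≠ r → s v ≠ v

/-- Pure Nash equilibrium (the induced network is *stable*): no agent can strictly
decrease her cost by unilaterally switching her activated edge to another node. -/
def IsStable (r : Fin (n + 1)) (s : Fin (n + 1) → Fin (n + 1)) : Prop :=
  ValidProfile r s ∧
    ∀ v, v ≠ r → ∀ w, w ≠ v → cost r s v ≤ cost r (Function.update s v w) v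

/-- Social cost: the sum of the costs of all agents (the non-root nodes). -/
def SC (s : Fin (n + 1) → Fin (n + 1)) : ℝ≥0∞ :=
  ∑ v ∈ Finset.univ.erase (0 : Fin (n + 1)), cost 0 s v

/-- Height of the induced network: the maximum length of a (leaf-to-)root path,
i.e. the least `k` such that every node arrives at the root after `k` steps. -/
def height (s : Fin (n + 1) → Fin (n + 1)) : ℕ :=
  sInf {k | ∀ v, s^[k] v = 0}

/-- Fairness Ratio: maximum agent cost divided by minimum agent cost. -/
def FR (s : Fin (n + 1) → Fin (n + 1)) : ℝ≥0∞ :=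
  (⨆ (v : Fin (n + 1)) (_ : v ≠ 0), cost 0 s v) /
    (⨅ (v : Fin (n + 1)) (_ : v ≠ 0), cost 0 s v)

/-! ### Reachability and subtrees -/

/-- `w` lies in the subtree of `u`. -/
def Reaches (s : Fin (n + 1) → Fin (n + 1)) (w u : Fin (n + 1)) : Prop :=
  ∃ k, s^[k] w = u

/-- The subtree of `u` as a finset. -/
def subtree (s : Fin (n + 1) → Fin (n + 1)) (u : Fin (n + 1)) : Finset (Fin (n + 1)) :=
  Finset.univ.filter fun w => Reaches s w u

/-- The agents pointing to `v`. -/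
def children (s : Fin (n + 1) → Fin (n + 1)) (v : Fin (n + 1)) : Finset (Fin (n + 1)) :=
  Finset.univ.filter fun u => u ≠ 0 ∧ s u = v

section Reachability

variable {s : Fin (n + 1) → Fin (n + 1)} {u v w : Fin (n + 1)}

lemma mem_subtree : w ∈ subtree s u ↔ Reaches s w u := by simp [subtree]

lemma mem_children : u ∈ children s v ↔ u ≠ 0 ∧ s u = v := by simp [children]

lemma subtreeSize_eq_card (s : Fin (n + 1) → Fin (n + 1)) (u : Fin (n + 1)) :
    subtreeSize s u = (subtree s u).card := by
  rw [subtreeSize, Nat.card_eq_fintype_card, Fintype.card_subtype]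
  rfl

lemma indeg_eq_card (s : Fin (n + 1) → Fin (n + 1)) (v : Fin (n + 1)) :
    indeg 0 s v = (children s v).card := by
  rw [indeg, Nat.card_eq_fintype_card, Fintype.card_subtype]
  rfl

lemma Reaches.refl (s : Fin (n + 1) → Fin (n + 1)) (u : Fin (n + 1)) : Reaches s u u :=
  ⟨0, rfl⟩

lemma Reaches.step (s : Fin (n + 1) → Fin (n + 1)) (u : Fin (n + 1)) : Reaches s u (s u) :=
  ⟨1, rfl⟩

lemma Reaches.trans (h₁ : Reaches s u v) (h₂ : Reaches s v w) : Reaches s u w := by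
  obtain ⟨j, rfl⟩ := h₁
  obtain ⟨k, rfl⟩ := h₂
  exact ⟨k + j, iterate_add_apply s k j u⟩

lemma Reaches.total (h₁ : Reaches s u v) (h₂ : Reaches s u w) :
    Reaches s v w ∨ Reaches s w v := by
  obtain ⟨j, rfl⟩ := h₁
  obtain ⟨k, rfl⟩ := h₂
  rcases le_total j k with h | h
  · left
    refine ⟨k - j, ?_⟩
    rw [← iterate_add_apply, Nat.sub_add_cancel h]
  · right
    refine ⟨j - k, ?_⟩
    rw [← iterate_add_apply, Nat.sub_add_cancel h]

lemma Reaches.eq_or_step (h : Reaches s u v) : u = v ∨ Reaches s (s u) v := by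
  obtain ⟨_ | k, rfl⟩ := h
  · exact Or.inl rfl
  · exact Or.inr ⟨k, (iterate_succ_apply s k u).symm⟩

lemma not_reaches_of_step (h0 : s 0 = 0) (hr : ∀ v, ∃ k, s^[k] v = 0) (hv : v ≠ 0) :
    ¬ Reaches s (s v) v := by
  rintro ⟨k, hk⟩
  have hp : IsPeriodicPt s (k + 1) v := hk
  obtain ⟨N, hN⟩ := hr v
  have h1 : s^[(k + 1) * N] v = v := hp.mul_const N
  have h2 : s^[k * N + N] v = 0 := by
    rw [iterate_add_apply, hN]
    exact iterate_fixed h0 _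
  apply hv
  rw [← h1, ← h2]
  congr 1
  ring_nf

lemma subtreeSize_pos (s : Fin (n + 1) → Fin (n + 1)) (u : Fin (n + 1)) :
    0 < subtreeSize s u := by
  rw [subtreeSize_eq_card, Finset.card_pos]
  exact ⟨u, mem_subtree.2 (Reaches.refl s u)⟩

lemma subtreeSize_le (s : Fin (n + 1) → Fin (n + 1)) (u : Fin (n + 1)) :
    subtreeSize s u ≤ n + 1 := by
  rw [subtreeSize_eq_card]
  simpa using Finset.card_le_univ (subtree s u)

lemma not_reaches_sibling (h0 : s 0 = 0) (hr : ∀ v, ∃ k, s^[k] v = 0) (hv : v ≠ 0)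
    (hne : w ≠ v) (hs : s w = s v) : ¬ Reaches s w v := by
  intro h
  rcases h.eq_or_step with h | h
  · exact hne h
  · rw [hs] at h
    exact not_reaches_of_step h0 hr hv h

lemma disjoint_subtree (h0 : s 0 = 0) (hr : ∀ v, ∃ k, s^[k] v = 0) (hv : v ≠ 0)
    (hw : w ≠ 0) (hne : w ≠ v) (hs : s w = s v) :
    Disjoint (subtree s v) (subtree s w) := by
  rw [Finset.disjoint_left]
  intro y hy hy'
  rw [mem_subtree] at hy hy'
  rcases hy.total hy' with h | h
  · exact not_reaches_sibling h0 hr hw hne.symm hs.symm h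
  · exact not_reaches_sibling h0 hr hv hne hs h

lemma subtree_eq (h0 : s 0 = 0) (v : Fin (n + 1)) :
    subtree s v = insert v ((children s v).biUnion (subtree s)) := by
  ext y
  simp only [mem_subtree, Finset.mem_insert, Finset.mem_biUnion, mem_children]
  constructor
  · intro h
    have hk := Nat.find_spec h
    have hmin := fun m => Nat.find_min (m := m) h
    set k := Nat.find h
    rcases Nat.eq_zero_or_pos k with hz | hpos
    · left
      rw [hz] at hk
      exact hk
    · right
      obtain ⟨j, hj⟩ : ∃ j, k = j + 1 := ⟨k - 1, by omega⟩
      rw [hj, iterate_succ_apply'] at hk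
      refine ⟨s^[j] y, ⟨fun hz => ?_, hk⟩, j, rfl⟩
      refine hmin j (by omega) ?_
      rw [hz, h0] at hk
      rw [hz, hk]
  · rintro (rfl | ⟨q, ⟨-, rfl⟩, h⟩)
    · exact Reaches.refl s y
    · exact h.trans (Reaches.step s q)

lemma subtreeSize_eq_sum (h0 : s 0 = 0) (hr : ∀ v, ∃ k, s^[k] v = 0) (v : Fin (n + 1)) :
    subtreeSize s v = (∑ q ∈ children s v, subtreeSize s q) + 1 := by
  rw [subtreeSize_eq_card, subtree_eq h0, Finset.card_insert_of_notMem,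
    Finset.card_biUnion]
  · simp only [subtreeSize_eq_card]
  · intro a ha b hb hab
    rw [Finset.mem_coe, mem_children] at ha hb
    exact disjoint_subtree h0 hr ha.1 hb.1 hab.symm (hb.2.trans ha.2.symm)
  · simp only [mem_subtree, Finset.mem_biUnion, mem_children, not_exists, not_and]
    rintro q ⟨hq, rfl⟩
    exact not_reaches_of_step h0 hr hq

lemma subtreeSize_lt_step (h0 : s 0 = 0) (hr : ∀ v, ∃ k, s^[k] v = 0) (hv : v ≠ 0) :
    subtreeSize s v < subtreeSize s (s v) := by
  rw [subtreeSize_eq_sum h0 hr (s v), Nat.lt_succ_iff]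
  exact Finset.single_le_sum (f := subtreeSize s) (fun _ _ => Nat.zero_le _)
    (mem_children.2 ⟨hv, rfl⟩)

lemma indeg_step_pos (hv : v ≠ 0) : 0 < indeg 0 s (s v) := by
  rw [indeg_eq_card, Finset.card_pos]
  exact ⟨v, mem_children.2 ⟨hv, rfl⟩⟩

lemma exists_large_child (h0 : s 0 = 0) (hr : ∀ v, ∃ k, s^[k] v = 0)
    (hd : 0 < indeg 0 s v) :
    ∃ q, q ≠ 0 ∧ s q = v ∧ subtreeSize s v ≤ indeg 0 s v * subtreeSize s q + 1 := by
  rw [indeg_eq_card, Finset.card_pos] at hd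
  obtain ⟨q, hq, hmax⟩ := Finset.exists_max_image (children s v) (subtreeSize s) hd
  refine ⟨q, (mem_children.1 hq).1, (mem_children.1 hq).2, ?_⟩
  rw [subtreeSize_eq_sum h0 hr v, indeg_eq_card, ← smul_eq_mul]
  exact Nat.succ_le_succ (Finset.sum_le_card_nsmul _ _ _ hmax)

end Reachability

/-! ### Costs -/

section Cost

variable {s : Fin (n + 1) → Fin (n + 1)} {u v w x : Fin (n + 1)}

lemma cost_zero (s : Fin (n + 1) → Fin (n + 1)) : cost 0 s 0 = 0 := by
  have h : ∃ k, s^[k] (0 : Fin (n + 1)) = 0 := ⟨0, rfl⟩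
  have hf : Nat.find h = 0 := (Nat.find_eq_zero h).2 rfl
  rw [cost, dif_pos h, hf, Finset.sum_range_zero]

lemma cost_eq_add (s : Fin (n + 1) → Fin (n + 1)) (hv : v ≠ 0) :
    cost 0 s v = (indeg 0 s (s v) : ℝ≥0∞) / (subtreeSize s v : ℝ≥0∞) + cost 0 s (s v) := by
  by_cases h : ∃ k, s^[k] (s v) = 0
  · have h' : ∃ k, s^[k] v = 0 := ⟨_, (iterate_succ_apply s _ v).trans h.choose_spec⟩
    have hf : Nat.find h' = Nat.find h + 1 := Nat.find_comp_succ h' h hv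
    rw [cost, dif_pos h', cost, dif_pos h, hf, Finset.sum_range_succ', add_comm]
    rfl
  · have h' : ¬ ∃ k, s^[k] v = 0 := by
      rintro ⟨_ | k, hk⟩
      · exact hv hk
      · exact h ⟨k, hk⟩
    rw [cost, dif_neg h', cost, dif_neg h, add_top]

lemma indeg_div_subtreeSize_ne_top (s : Fin (n + 1) → Fin (n + 1)) (u v : Fin (n + 1)) :
    (indeg 0 s u : ℝ≥0∞) / (subtreeSize s v : ℝ≥0∞) ≠ ⊤ :=
  ENNReal.div_ne_top (ENNReal.natCast_ne_top _)
    (Nat.cast_ne_zero.2 (subtreeSize_pos s v).ne')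

lemma cost_ne_top (hr : ∀ v, ∃ k, s^[k] v = 0) (v : Fin (n + 1)) : cost 0 s v ≠ ⊤ := by
  rw [cost, dif_pos (hr v)]
  exact ENNReal.sum_ne_top.2 fun k _ => indeg_div_subtreeSize_ne_top s _ _

/-- The cost of a node as a real number. -/
def realCost (s : Fin (n + 1) → Fin (n + 1)) (v : Fin (n + 1)) : ℝ := (cost 0 s v).toReal

lemma realCost_eq_add (hr : ∀ v, ∃ k, s^[k] v = 0) (hv : v ≠ 0) :
    realCost s v = (indeg 0 s (s v) : ℝ) / subtreeSize s v + realCost s (s v) := by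
  rw [realCost, cost_eq_add s hv,
    ENNReal.toReal_add (indeg_div_subtreeSize_ne_top s _ _) (cost_ne_top hr _)]
  simp [realCost]

lemma iterate_update_of_forall_ne {k : ℕ} (h : ∀ j < k, s^[j] x ≠ v) :
    (update s v w)^[k] x = s^[k] x := by
  induction k with
  | zero => rfl
  | succ k ih =>
    rw [iterate_succ_apply', iterate_succ_apply', ih fun j hj => h j (by omega),
      update_of_ne (h k (by omega))]

lemma Reaches.update_self (w : Fin (n + 1)) (h : Reaches s x v) :
    Reaches (update s v w) x v := by
  refine ⟨Nat.find h, ?_⟩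
  rw [iterate_update_of_forall_ne fun j hj => Nat.find_min h hj]
  exact Nat.find_spec h

lemma Reaches.update_of_reaches (h : Reaches s x u) (hu : Reaches (update s v w) v u) :
    Reaches (update s v w) x u := by
  by_cases hx : Reaches s x v
  · exact (hx.update_self w).trans hu
  · obtain ⟨k, hk⟩ := h
    exact ⟨k, (iterate_update_of_forall_ne fun j _ hj => hx ⟨j, hj⟩).trans hk⟩

lemma reaches_update (hw : ¬ Reaches s w v) (h : Reaches s w u) :
    Reaches (update s v w) v u := by
  obtain ⟨k, hk⟩ := h
  refine ⟨k + 1, ?_⟩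
  rw [iterate_succ_apply, update_self,
    iterate_update_of_forall_ne fun j _ hj => hw ⟨j, hj⟩, hk]

lemma subtree_subset_update (hu : Reaches (update s v w) v u) :
    subtree s u ⊆ subtree (update s v w) u := fun _ hy =>
  mem_subtree.2 ((mem_subtree.1 hy).update_of_reaches hu)

lemma subtreeSize_le_update (hu : Reaches (update s v w) v u) :
    subtreeSize s u ≤ subtreeSize (update s v w) u := by
  rw [subtreeSize_eq_card, subtreeSize_eq_card]
  exact Finset.card_le_card (subtree_subset_update hu)

lemma children_update_subset (hu : u ≠ w) : children (update s v w) u ⊆ children s u := by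
  intro y hy
  rw [mem_children] at hy ⊢
  refine ⟨hy.1, ?_⟩
  by_cases hyv : y = v
  · subst hyv
    exact absurd (by simpa using hy.2.symm) hu
  · simpa [update_of_ne hyv] using hy.2

lemma indeg_update_le (hu : u ≠ w) : indeg 0 (update s v w) u ≤ indeg 0 s u := by
  rw [indeg_eq_card, indeg_eq_card]
  exact Finset.card_le_card (children_update_subset hu)

lemma indeg_update_le_succ (s : Fin (n + 1) → Fin (n + 1)) (v w u : Fin (n + 1)) :
    indeg 0 (update s v w) u ≤ indeg 0 s u + 1 := by
  rw [indeg_eq_card, indeg_eq_card]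
  refine (Finset.card_le_card ?_).trans (Finset.card_insert_le v _)
  intro y hy
  rw [mem_children] at hy
  rw [Finset.mem_insert, mem_children]
  by_cases hyv : y = v
  · exact Or.inl hyv
  · exact Or.inr ⟨hy.1, by simpa [update_of_ne hyv] using hy.2⟩

lemma cost_update_le (h0 : s 0 = 0) (hr : ∀ v, ∃ k, s^[k] v = 0)
    (hw : ¬ Reaches s w v) (hx : Reaches s w x) :
    cost 0 (update s v w) x ≤ cost 0 s x := by
  obtain ⟨k, hk⟩ := hr x
  induction k generalizing x with
  | zero =>
    obtain rfl : x = 0 := hk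
    simp [cost_zero]
  | succ k ih =>
    by_cases hx0 : x = 0
    · subst hx0
      simp [cost_zero]
    have hxv : x ≠ v := fun h => hw (h ▸ hx)
    have hsx : s x ≠ w := fun h => not_reaches_of_step h0 hr hx0 (h ▸ hx)
    rw [cost_eq_add s hx0, cost_eq_add _ hx0, update_of_ne hxv]
    refine add_le_add (ENNReal.div_le_div ?_ ?_) (ih (hx.trans (Reaches.step s x)) hk)
    · exact_mod_cast indeg_update_le hsx
    · exact_mod_cast subtreeSize_le_update (reaches_update hw hx)

lemma cost_deviation_le (hv : v ≠ 0) (w : Fin (n + 1)) :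
    cost 0 (update s v w) v ≤
      ((indeg 0 s w + 1 : ℕ) : ℝ≥0∞) / (subtreeSize s v : ℝ≥0∞) +
        cost 0 (update s v w) w := by
  rw [cost_eq_add _ hv, update_self]
  refine add_le_add (ENNReal.div_le_div ?_ ?_) le_rfl
  · exact_mod_cast indeg_update_le_succ s v w w
  · exact_mod_cast subtreeSize_le_update (Reaches.refl _ v)

lemma IsStable.realCost_le (hst : IsStable 0 s) (hr : ∀ v, ∃ k, s^[k] v = 0)
    (hv : v ≠ 0) (hw : ¬ Reaches s w v) :
    realCost s v ≤ ((indeg 0 s w : ℝ) + 1) / subtreeSize s v + realCost s w := by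
  have h := ((hst.2 v hv w fun h => hw (h ▸ Reaches.refl s v)).trans
    (cost_deviation_le hv w)).trans
    (add_le_add le_rfl (cost_update_le hst.1.1 hr hw (Reaches.refl s w)))
  have hf : ((indeg 0 s w + 1 : ℕ) : ℝ≥0∞) / (subtreeSize s v : ℝ≥0∞) ≠ ⊤ :=
    ENNReal.div_ne_top (ENNReal.natCast_ne_top _)
      (Nat.cast_ne_zero.2 (subtreeSize_pos s v).ne')
  have h' := ENNReal.toReal_mono (ENNReal.add_ne_top.2 ⟨hf, cost_ne_top hr w⟩) h
  rw [ENNReal.toReal_add hf (cost_ne_top hr w)] at h'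
  simp only [ENNReal.toReal_div, ENNReal.toReal_natCast] at h'
  push_cast at h'
  exact h'

lemma subtreeSize_add_le_update (h0 : s 0 = 0) (hr : ∀ v, ∃ k, s^[k] v = 0)
    (hv : v ≠ 0) (hw : w ≠ 0) (hne : w ≠ v) (hs : s w = s v) :
    subtreeSize s v + subtreeSize s w ≤ subtreeSize (update s v w) w := by
  have hvw : Reaches (update s v w) v w :=
    reaches_update (not_reaches_sibling h0 hr hv hne hs) (Reaches.refl s w)
  rw [subtreeSize_eq_card, subtreeSize_eq_card, subtreeSize_eq_card,
    ← Finset.card_union_of_disjoint (disjoint_subtree h0 hr hv hw hne hs)]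
  refine Finset.card_le_card (Finset.union_subset ?_ (subtree_subset_update hvw))
  intro y hy
  exact mem_subtree.2 (((mem_subtree.1 hy).update_self w).trans hvw)

lemma IsStable.sibling_le (hst : IsStable 0 s) (hr : ∀ v, ∃ k, s^[k] v = 0)
    (hv : v ≠ 0) (hw : w ≠ 0) (hne : w ≠ v) (hs : s w = s v) :
    (indeg 0 s (s v) : ℝ) / subtreeSize s v ≤
      ((indeg 0 s w : ℝ) + 1) / subtreeSize s v +
        (indeg 0 s (s v) : ℝ) / ((subtreeSize s v : ℝ) + subtreeSize s w) := by
  have h0 := hst.1.1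
  have hnr := not_reaches_sibling h0 hr hv hne hs
  have hsw : s w ≠ w := hst.1.2 w hw
  have h := (hst.2 v hv w hne).trans (cost_deviation_le hv w)
  have hcw : cost 0 (update s v w) w ≤
      (indeg 0 s (s v) : ℝ≥0∞) / ((subtreeSize s v + subtreeSize s w : ℕ) : ℝ≥0∞) +
        cost 0 s (s v) := by
    rw [cost_eq_add _ hw, update_of_ne hne, ← hs]
    refine add_le_add (ENNReal.div_le_div ?_ ?_) (cost_update_le h0 hr hnr (Reaches.step s w))
    · exact_mod_cast indeg_update_le hsw
    · exact_mod_cast subtreeSize_add_le_update h0 hr hv hw hne hs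
  have h := h.trans (add_le_add le_rfl hcw)
  have hf : ((indeg 0 s w + 1 : ℕ) : ℝ≥0∞) / (subtreeSize s v : ℝ≥0∞) ≠ ⊤ :=
    ENNReal.div_ne_top (ENNReal.natCast_ne_top _)
      (Nat.cast_ne_zero.2 (subtreeSize_pos s v).ne')
  have hf2 : (indeg 0 s (s v) : ℝ≥0∞) / ((subtreeSize s v + subtreeSize s w : ℕ) : ℝ≥0∞) ≠ ⊤ :=
    ENNReal.div_ne_top (ENNReal.natCast_ne_top _)
      (Nat.cast_ne_zero.2 (Nat.add_pos_left (subtreeSize_pos s v) _).ne')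
  have hf3 := ENNReal.add_ne_top.2 ⟨hf2, cost_ne_top hr (s v)⟩
  have h' := ENNReal.toReal_mono (ENNReal.add_ne_top.2 ⟨hf, hf3⟩) h
  rw [ENNReal.toReal_add hf hf3, ENNReal.toReal_add hf2 (cost_ne_top hr _)] at h'
  have h2 := realCost_eq_add hr hv
  simp only [realCost] at h2
  rw [h2] at h'
  simp only [ENNReal.toReal_div, ENNReal.toReal_natCast] at h'
  push_cast at h'
  linarith

end Cost

/-! ### Structure of stable trees -/

section Stable

variable {s : Fin (n + 1) → Fin (n + 1)} {u v w : Fin (n + 1)}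

lemma IsStable.grandparent_le (hst : IsStable 0 s) (hr : ∀ v, ∃ k, s^[k] v = 0)
    (hv : v ≠ 0) (hp : s v ≠ 0) :
    subtreeSize s v * indeg 0 s (s (s v)) + subtreeSize s (s v) * indeg 0 s (s v) ≤
      subtreeSize s (s v) * (indeg 0 s (s (s v)) + 1) := by
  have hnr : ¬ Reaches s (s (s v)) v := fun h =>
    not_reaches_of_step hst.1.1 hr hv ((Reaches.step s (s v)).trans h)
  have h := hst.realCost_le hr hv hnr
  rw [realCost_eq_add hr hv, realCost_eq_add hr hp] at h
  have ha : (0 : ℝ) < subtreeSize s v := by exact_mod_cast subtreeSize_pos s v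
  have hb : (0 : ℝ) < subtreeSize s (s v) := by exact_mod_cast subtreeSize_pos s (s v)
  have h' : (indeg 0 s (s v) : ℝ) / subtreeSize s v +
      (indeg 0 s (s (s v)) : ℝ) / subtreeSize s (s v) ≤
      ((indeg 0 s (s (s v)) : ℝ) + 1) / subtreeSize s v := by linarith
  rw [div_add_div _ _ ha.ne' hb.ne', div_le_div_iff₀ (by positivity) ha] at h'
  have h'' : (subtreeSize s v : ℝ) * indeg 0 s (s (s v)) +
      subtreeSize s (s v) * indeg 0 s (s v) ≤
      subtreeSize s (s v) * (indeg 0 s (s (s v)) + 1) := by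
    refine le_of_mul_le_mul_left ?_ ha
    linarith
  exact_mod_cast h''

lemma IsStable.indeg_le_step (hst : IsStable 0 s) (hr : ∀ v, ∃ k, s^[k] v = 0)
    (hv : v ≠ 0) : indeg 0 s v ≤ indeg 0 s (s v) := by
  rcases Nat.eq_zero_or_pos (indeg 0 s v) with h | h
  · omega
  rw [indeg_eq_card, gt_iff_lt, Finset.card_pos] at h
  obtain ⟨q, hq⟩ := h
  obtain ⟨hq0, rfl⟩ := mem_children.1 hq
  have h := hst.grandparent_le hr hq0 hv
  have ha := subtreeSize_pos s q
  have hd : 0 < indeg 0 s (s (s q)) := indeg_step_pos hv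
  by_contra! hlt
  nlinarith [Nat.mul_le_mul_left (subtreeSize s (s q)) hlt, Nat.mul_pos ha hd]

lemma IsStable.leaf_of_indeg_eq (hst : IsStable 0 s) (hr : ∀ v, ∃ k, s^[k] v = 0)
    (hv : v ≠ 0) (hp : s v ≠ 0) (hg : s (s v) ≠ 0) {d : ℕ}
    (h1 : indeg 0 s (s v) = d) (h2 : indeg 0 s (s (s v)) = d)
    (h3 : indeg 0 s (s (s (s v))) = d)
    (hv' : subtreeSize s (s v) ≤ d * subtreeSize s v + 1)
    (hp' : subtreeSize s (s (s v)) ≤ d * subtreeSize s (s v) + 1) :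
    subtreeSize s v = 1 := by
  have hnr : ¬ Reaches s (s (s (s v))) v := fun h =>
    not_reaches_of_step hst.1.1 hr hv
      ((Reaches.step s (s v)).trans ((Reaches.step s (s (s v))).trans h))
  have h := hst.realCost_le hr hv hnr
  have hd : 0 < d := h1 ▸ indeg_step_pos hv
  rw [realCost_eq_add hr hv, realCost_eq_add hr hp, realCost_eq_add hr hg, h1, h2, h3] at h
  have hpa := subtreeSize_pos s v
  have hpb := subtreeSize_pos s (s v)
  have hpc := subtreeSize_pos s (s (s v))
  generalize subtreeSize s v = a at *
  generalize subtreeSize s (s v) = b at *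
  generalize subtreeSize s (s (s v)) = c at *
  by_contra hne
  have ha2 : 2 ≤ a := by omega
  have ha : (2 : ℝ) ≤ a := by exact_mod_cast ha2
  have hb : (0 : ℝ) < b := by exact_mod_cast hpb
  have hc : (0 : ℝ) < c := by exact_mod_cast hpc
  have hd' : (1 : ℝ) ≤ d := by exact_mod_cast hd
  have hbu : (b : ℝ) ≤ d * a + 1 := by exact_mod_cast hv'
  have hcu : (c : ℝ) ≤ d * (d * a + 1) + 1 := by
    have : (c : ℝ) ≤ d * b + 1 := by exact_mod_cast hp'
    nlinarith
  have e1 : (d : ℝ) / (d * a + 1) ≤ d / b := by gcongr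
  have e2 : (d : ℝ) / (d * (d * a + 1) + 1) ≤ d / c := by gcongr
  have e3 : (d : ℝ) / (d * a + 1) + d / (d * (d * a + 1) + 1) ≤ 1 / a := by
    have : ((d : ℝ) + 1) / a = d / a + 1 / a := add_div _ _ _
    linarith
  have e4 : (1 : ℝ) / a - d / (d * a + 1) = 1 / (a * (d * a + 1)) := by
    field_simp
    ring
  have e5 : (d : ℝ) / (d * (d * a + 1) + 1) ≤ 1 / (a * (d * a + 1)) := by linarith
  rw [div_le_div_iff₀ (by positivity) (by positivity)] at e5
  have e6 : (1 : ℝ) * 2 ≤ d * a := by gcongr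
  nlinarith [mul_nonneg (mul_nonneg (by linarith : (0 : ℝ) ≤ d)
    (by linarith : (0 : ℝ) ≤ d * a + 1)) (by linarith : (0 : ℝ) ≤ (a : ℝ) - 2)]

lemma IsStable.subtreeSize_le_pow_aux (hst : IsStable 0 s) (hr : ∀ v, ∃ k, s^[k] v = 0)
    (N : ℕ) : ∀ p, subtreeSize s p ≤ N →
      subtreeSize s p ≤ (indeg 0 s p + 1) ^ (2 * indeg 0 s p + 2) ∧
      (p ≠ 0 → indeg 0 s (s p) = indeg 0 s p →
        subtreeSize s p ≤ (indeg 0 s p + 1) ^ (2 * indeg 0 s p + 1)) := by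
  have h0 := hst.1.1
  induction N with
  | zero => exact fun p hp => absurd (subtreeSize_pos s p) (by omega)
  | succ N ih =>
    intro p hN
    rcases Nat.eq_zero_or_pos (indeg 0 s p) with hd | hd
    · have h1 : subtreeSize s p = 1 := by
        rw [subtreeSize_eq_sum h0 hr]
        rw [indeg_eq_card, Finset.card_eq_zero] at hd
        simp [hd]
      simp [hd, h1]
    obtain ⟨q, hq0, rfl, hq⟩ := exists_large_child h0 hr hd
    have hlt := subtreeSize_lt_step h0 hr hq0
    obtain ⟨ih1, ih2⟩ := ih q (by omega)
    have hle := hst.indeg_le_step hr hq0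
    have hqpos := subtreeSize_pos s q
    have hmul : subtreeSize s (s q) ≤ (indeg 0 s (s q) + 1) * subtreeSize s q := by
      nlinarith
    rcases hle.eq_or_lt with heq | hlt'
    · refine ⟨?_, fun hp hpd => ?_⟩
      · have h2 := ih2 hq0 heq.symm
        rw [heq] at h2
        calc subtreeSize s (s q) ≤ _ := hmul
          _ ≤ _ := Nat.mul_le_mul_left _ h2
          _ = _ := by ring
      · obtain ⟨v, hv0, rfl, hv⟩ := exists_large_child h0 hr (heq ▸ hd)
        have h1 := hst.leaf_of_indeg_eq hr hv0 hq0 hp heq rfl hpd (heq ▸ hv) hq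
        rw [h1, heq, mul_one] at hv
        set d := indeg 0 s (s (s v))
        have h3 : subtreeSize s (s (s v)) ≤ (d + 1) ^ 2 := by nlinarith
        exact h3.trans (Nat.pow_le_pow_right (by omega) (by omega))
    · set d := indeg 0 s (s q)
      have h2 : subtreeSize s q ≤ (d + 1) ^ (2 * d) :=
        calc subtreeSize s q ≤ _ := ih1
          _ ≤ (d + 1) ^ (2 * indeg 0 s q + 2) := Nat.pow_le_pow_left (by omega) _
          _ ≤ _ := Nat.pow_le_pow_right (by omega) (by omega)
      have h3 : subtreeSize s (s q) ≤ (d + 1) ^ (2 * d + 1) :=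
        calc subtreeSize s (s q) ≤ _ := hmul
          _ ≤ _ := Nat.mul_le_mul_left _ h2
          _ = _ := by ring
      exact ⟨h3.trans (Nat.pow_le_pow_right (by omega) (by omega)), fun _ _ => h3⟩

lemma IsStable.subtreeSize_le_pow (hst : IsStable 0 s) (hr : ∀ v, ∃ k, s^[k] v = 0)
    (p : Fin (n + 1)) :
    subtreeSize s p ≤ (indeg 0 s p + 1) ^ (2 * indeg 0 s p + 2) :=
  (hst.subtreeSize_le_pow_aux hr _ p le_rfl).1

lemma IsStable.indeg_le_two_mul_sibling (hst : IsStable 0 s)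
    (hr : ∀ v, ∃ k, s^[k] v = 0) (hv : v ≠ 0) (hw : w ≠ 0) (hne : w ≠ v) (hs : s w = s v)
    (hle : subtreeSize s v ≤ subtreeSize s w) :
    indeg 0 s (s v) ≤ 2 * indeg 0 s w + 2 := by
  have h := hst.sibling_le hr hv hw hne hs
  have ha : (0 : ℝ) < subtreeSize s v := by exact_mod_cast subtreeSize_pos s v
  have hab : (subtreeSize s v : ℝ) ≤ subtreeSize s w := by exact_mod_cast hle
  have h2 : (indeg 0 s (s v) : ℝ) / ((subtreeSize s v : ℝ) + subtreeSize s w) ≤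
      indeg 0 s (s v) / (2 * subtreeSize s v) := by
    gcongr
    linarith
  have h3 := h.trans (add_le_add le_rfl h2)
  rw [div_add_div _ _ ha.ne' (by positivity), div_le_div_iff₀ ha (by positivity)] at h3
  have h4 : (indeg 0 s (s v) : ℝ) ≤ 2 * indeg 0 s w + 2 := by
    refine le_of_mul_le_mul_left ?_ (mul_pos ha ha)
    linarith
  exact_mod_cast h4

lemma IsStable.two_pow_sq_le_subtreeSize (hst : IsStable 0 s)
    (hr : ∀ v, ∃ k, s^[k] v = 0) (k : ℕ) :
    ∀ p, 4 ^ k ≤ indeg 0 s p → 2 ^ (k ^ 2) ≤ subtreeSize s p := by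
  induction k with
  | zero => exact fun p _ => by simpa using Nat.succ_le_of_lt (subtreeSize_pos s p)
  | succ k ih =>
    intro p hp
    have h4 : 1 ≤ 4 ^ k := Nat.one_le_pow _ _ (by norm_num)
    have hne : (children s p).Nonempty := by
      rw [← Finset.card_pos, ← indeg_eq_card]
      omega
    obtain ⟨v, hv, hmin⟩ := Finset.exists_min_image (children s p) (subtreeSize s) hne
    obtain ⟨hv0, rfl⟩ := mem_children.1 hv
    have hbig : ∀ w ∈ (children s (s v)).erase v, 2 ^ (k ^ 2) ≤ subtreeSize s w := by
      intro w hw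
      obtain ⟨hwv, hw⟩ := Finset.mem_erase.1 hw
      obtain ⟨hw0, hs⟩ := mem_children.1 hw
      have h := hst.indeg_le_two_mul_sibling hr hv0 hw0 hwv hs (hmin w hw)
      refine ih w ?_
      rw [pow_succ] at hp
      omega
    have hsum := Finset.card_nsmul_le_sum _ _ _ hbig
    have hsub : ∑ w ∈ (children s (s v)).erase v, subtreeSize s w ≤
        ∑ w ∈ children s (s v), subtreeSize s w :=
      Finset.sum_le_sum_of_subset (Finset.erase_subset _ _)
    rw [Finset.card_erase_of_mem hv, ← indeg_eq_card, smul_eq_mul] at hsum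
    rw [subtreeSize_eq_sum hst.1.1 hr]
    have hpow : 2 ^ ((k + 1) ^ 2) = (2 * 4 ^ k) * 2 ^ (k ^ 2) := by
      rw [show (4 : ℕ) ^ k = 2 ^ (2 * k) by rw [pow_mul]; norm_num]
      ring
    have hd : 2 * 4 ^ k ≤ indeg 0 s (s v) - 1 := by
      rw [pow_succ] at hp
      omega
    rw [hpow]
    exact (((Nat.mul_le_mul_right _ hd).trans hsum).trans hsub).trans (Nat.le_succ _)

lemma IsStable.log_indeg_le (hst : IsStable 0 s) (hr : ∀ v, ∃ k, s^[k] v = 0)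
    {p : Fin (n + 1)} (hp : 0 < indeg 0 s p) {z : ℝ} (hz : 0 ≤ z)
    (hn : Real.log ((n : ℝ) + 1) ≤ 2 * z ^ 2) :
    Real.log (indeg 0 s p) ≤ 4 * z + 2 := by
  set k := Nat.log 4 (indeg 0 s p)
  have h1 := (hst.two_pow_sq_le_subtreeSize hr k p (Nat.pow_log_le_self 4 hp.ne')).trans
    (subtreeSize_le s p)
  have h1' : (2 : ℝ) ^ (k ^ 2) ≤ (n : ℝ) + 1 := by exact_mod_cast h1
  have h2 := Real.log_le_log (by positivity) h1'
  rw [Real.log_pow] at h2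
  push_cast at h2
  have hl1 := Real.log_two_gt_d9
  have hl2 := Real.log_two_lt_d9
  have hk : (k : ℝ) ≤ 2 * z := by
    refine abs_le_of_sq_le_sq' ?_ (by positivity) |>.2
    nlinarith [sq_nonneg (k : ℝ)]
  have h3 : (indeg 0 s p : ℝ) ≤ 4 ^ (k + 1) := by
    exact_mod_cast (Nat.lt_pow_succ_log_self (by norm_num) _).le
  have h4 := Real.log_le_log (by exact_mod_cast hp) h3
  rw [Real.log_pow, show (4 : ℝ) = 2 ^ 2 by norm_num, Real.log_pow] at h4
  push_cast at h4
  nlinarith [(Nat.cast_nonneg k : (0 : ℝ) ≤ k)]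

end Stable

/-! ### Length of a path in a stable tree -/

lemma one_le_mul_log_sub {x y m : ℝ} (hx : 0 < x) (hy : 0 < y) (hm : 0 ≤ m)
    (h : y ≤ m * (y - x)) : 1 ≤ m * (Real.log y - Real.log x) := by
  have h1 := Real.one_sub_inv_le_log_of_pos (div_pos hy hx)
  rw [Real.log_div hy.ne' hx.ne', inv_div] at h1
  have h2 : 1 ≤ m * (1 - x / y) := by
    rw [one_sub_div hy.ne', mul_div_assoc', le_div_iff₀ hy]
    linarith
  exact h2.trans (mul_le_mul_of_nonneg_left h1 hm)

lemma step_potential {a b x y m : ℕ} (hm : 3 ≤ m) (ha : 0 < a) (hx : 0 < x)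
    (hab : a < b) (hxy : x ≤ y) (hstep : a * y + b * x ≤ b * (y + 1))
    (hsize : b ≤ (x + 1) ^ (2 * x + 2)) :
    16 * min (Real.log a) (Real.log ((m : ℝ) ^ (2 * m))) +
        Real.log a / Real.log ((m : ℝ) / 2) + m * Real.log x + 1 ≤
      16 * min (Real.log b) (Real.log ((m : ℝ) ^ (2 * m))) +
        Real.log b / Real.log ((m : ℝ) / 2) + m * Real.log y := by
  have hm' : (3 : ℝ) ≤ m := by exact_mod_cast hm
  have ha' : (0 : ℝ) < a := by exact_mod_cast ha
  have hb' : (0 : ℝ) < b := by exact_mod_cast ha.trans hab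
  have hab' : (a : ℝ) + 1 ≤ b := by exact_mod_cast hab
  have hx' : (0 : ℝ) < x := by exact_mod_cast hx
  have hxy' : (x : ℝ) ≤ y := by exact_mod_cast hxy
  have hy' : (0 : ℝ) < y := hx'.trans_le hxy'
  have hstep' : (a : ℝ) * y + b * x ≤ b * (y + 1) := by exact_mod_cast hstep
  have hlogab : Real.log a ≤ Real.log b := Real.log_le_log ha' (by linarith)
  have hlogxy : Real.log x ≤ Real.log y := Real.log_le_log hx' hxy'
  have hlogm : 0 < Real.log ((m : ℝ) / 2) := Real.log_pos (by linarith)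
  have hmin : min (Real.log a) (Real.log ((m : ℝ) ^ (2 * m))) ≤
      min (Real.log b) (Real.log ((m : ℝ) ^ (2 * m))) := min_le_min_right _ hlogab
  have hdiv : Real.log a / Real.log ((m : ℝ) / 2) ≤ Real.log b / Real.log ((m : ℝ) / 2) := by
    gcongr
  have hmul : (m : ℝ) * Real.log x ≤ m * Real.log y := by gcongr
  by_cases hym : y < m
  · rcases hxy.eq_or_lt with rfl | hlt
    · have hbm : (b : ℝ) ≤ (m : ℝ) ^ (2 * m) := by
        have : b ≤ m ^ (2 * m) :=
          calc b ≤ _ := hsize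
            _ ≤ m ^ (2 * x + 2) := Nat.pow_le_pow_left (by omega) _
            _ ≤ _ := Nat.pow_le_pow_right (by omega) (by omega)
        exact_mod_cast this
      have hlb := Real.log_le_log hb' hbm
      rw [min_eq_left hlb, min_eq_left (hlogab.trans hlb)]
      have key : 1 ≤ 16 * (Real.log b - Real.log a) := by
        refine one_le_mul_log_sub ha' hb' (by norm_num) ?_
        rcases Nat.lt_or_ge x 2 with h | h
        · obtain rfl : x = 1 := by omega
          have hb16 : (b : ℝ) ≤ 16 := by exact_mod_cast (by simpa using hsize)
          linarith
        · have h2 : (2 : ℝ) ≤ x := by exact_mod_cast h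
          nlinarith
      linarith
    · have hlt' : (x : ℝ) + 1 ≤ y := by exact_mod_cast hlt
      have hym' : (y : ℝ) ≤ m := by exact_mod_cast hym.le
      have key : 1 ≤ (m : ℝ) * (Real.log y - Real.log x) :=
        one_le_mul_log_sub hx' hy' (by linarith) (by nlinarith)
      linarith
  · have hym' : (m : ℝ) ≤ y := by exact_mod_cast not_lt.1 hym
    by_cases hjump : (y : ℝ) ≤ m * (y - x)
    · have key := one_le_mul_log_sub hx' hy' (by linarith) hjump
      linarith
    · push Not at hjump
      have hgrow : (m : ℝ) / 2 * a ≤ b := by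
        refine le_of_mul_le_mul_right ?_ hy'
        have e1 : (a : ℝ) * y ≤ b * (y - x + 1) := by linarith
        have e2 : (m : ℝ) * (a * y) ≤ b * (m * (y - x + 1)) := by
          calc (m : ℝ) * (a * y) ≤ m * (b * (y - x + 1)) := by gcongr
            _ = _ := by ring
        have e3 : (b : ℝ) * (m * (y - x + 1)) ≤ b * (2 * y) :=
          mul_le_mul_of_nonneg_left (by linarith) hb'.le
        linarith
      have hl := Real.log_le_log (by positivity) hgrow
      rw [Real.log_mul (by positivity) ha'.ne'] at hl
      have key : 1 + Real.log a / Real.log ((m : ℝ) / 2) ≤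
          Real.log b / Real.log ((m : ℝ) / 2) := by
        rw [le_div_iff₀ hlogm, add_mul, div_mul_cancel₀ _ hlogm.ne']
        linarith
      linarith

lemma path_length_le {N m : ℕ} {a x : ℕ → ℕ} (hm : 3 ≤ m) (ha : ∀ i, 0 < a i)
    (hx : ∀ i ≤ N, 0 < x i) (hlt : ∀ i < N, a i < a (i + 1))
    (hmono : ∀ i < N, x i ≤ x (i + 1))
    (hstep : ∀ i < N, a i * x (i + 1) + a (i + 1) * x i ≤ a (i + 1) * (x (i + 1) + 1))
    (hsize : ∀ i < N, a (i + 1) ≤ (x i + 1) ^ (2 * x i + 2)) :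
    (N : ℝ) ≤ 16 * Real.log ((m : ℝ) ^ (2 * m)) +
      Real.log (a N) / Real.log ((m : ℝ) / 2) + m * Real.log (x N) := by
  have hm' : (3 : ℝ) ≤ m := by exact_mod_cast hm
  have key : ∀ i ≤ N, (i : ℝ) ≤ 16 * min (Real.log (a i)) (Real.log ((m : ℝ) ^ (2 * m))) +
      Real.log (a i) / Real.log ((m : ℝ) / 2) + m * Real.log (x i) := by
    intro i
    induction i with
    | zero =>
      intro _
      have h1 : 0 ≤ Real.log (a 0) := Real.log_natCast_nonneg _
      have h2 : 0 ≤ Real.log (x 0) := Real.log_natCast_nonneg _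
      have h3 : 0 ≤ Real.log ((m : ℝ) / 2) := Real.log_nonneg (by linarith)
      have h4 : 0 ≤ Real.log ((m : ℝ) ^ (2 * m)) :=
        Real.log_nonneg (one_le_pow₀ (by linarith))
      have h5 := le_min h1 h4
      rw [Nat.cast_zero]
      positivity
    | succ i ih =>
      intro hi
      have := step_potential hm (ha i) (hx i (by omega)) (hlt i hi) (hmono i hi)
        (hstep i hi) (hsize i hi)
      have := ih (by omega)
      push_cast
      linarith
  have := key N le_rfl
  have := min_le_right (Real.log (a N)) (Real.log ((m : ℝ) ^ (2 * m)))
  linarith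

lemma IsStable.path_length_le {s : Fin (n + 1) → Fin (n + 1)} (hst : IsStable 0 s)
    (hr : ∀ v, ∃ k, s^[k] v = 0) {N m : ℕ} (hm : 3 ≤ m) {v : Fin (n + 1)}
    (hv : s^[N] v ≠ 0) :
    (N : ℝ) ≤ 16 * Real.log ((m : ℝ) ^ (2 * m)) +
      Real.log ((n : ℝ) + 1) / Real.log ((m : ℝ) / 2) +
        m * Real.log (indeg 0 s (s^[N + 1] v)) := by
  have h0 := hst.1.1
  have hne : ∀ i ≤ N, s^[i] v ≠ 0 := by
    intro i hi hz
    apply hv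
    rw [← Nat.sub_add_cancel hi, iterate_add_apply, hz]
    exact iterate_fixed h0 _
  have hs : ∀ i, s^[i + 1] v = s (s^[i] v) := fun i => iterate_succ_apply' s i v
  have h := TCG.path_length_le (N := N) (m := m) (a := fun i => subtreeSize s (s^[i] v))
    (x := fun i => indeg 0 s (s^[i + 1] v)) hm (fun i => subtreeSize_pos s _)
    (fun i hi => by simpa only [hs] using indeg_step_pos (hne i hi))
    (fun i hi => by simpa only [hs] using subtreeSize_lt_step h0 hr (hne i hi.le))
    (fun i hi => by
      simpa only [hs] using hst.indeg_le_step hr (by simpa only [hs] using hne (i + 1) hi))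
    (fun i hi => by
      simpa only [hs] using
        hst.grandparent_le hr (hne i hi.le) (by simpa only [hs] using hne (i + 1) hi))
    (fun i hi => hst.subtreeSize_le_pow hr _)
  refine h.trans ?_
  have hm' : (3 : ℝ) ≤ m := by exact_mod_cast hm
  have hlogm : 0 < Real.log ((m : ℝ) / 2) := Real.log_pos (by linarith)
  have hsz : (subtreeSize s (s^[N] v) : ℝ) ≤ (n : ℝ) + 1 := by
    exact_mod_cast subtreeSize_le s _
  have hpos : (0 : ℝ) < subtreeSize s (s^[N] v) := by exact_mod_cast subtreeSize_pos s _
  gcongr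

lemma IsStable.length_succ_le {s : Fin (n + 1) → Fin (n + 1)} (hn : 3 ≤ n)
    (hst : IsStable 0 s) (hr : ∀ v, ∃ k, s^[k] v = 0) {N : ℕ} {v : Fin (n + 1)}
    (hv : s^[N] v ≠ 0) :
    (N : ℝ) + 1 ≤ 5000 * (Real.log (n : ℝ) / Real.log (Real.log (n : ℝ))) := by
  have hn' : (3 : ℝ) ≤ n := by exact_mod_cast hn
  have hL1 : 1 < Real.log n := by
    rw [Real.lt_log_iff_exp_lt (by linarith)]
    linarith [Real.exp_one_lt_d9]
  set L := Real.log n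
  have hl : 0 < Real.log L := Real.log_pos hL1
  set y := Real.exp (Real.log L / 8)
  have hy8 : y ^ 8 = L := by
    rw [← Real.exp_nat_mul]
    push_cast
    rw [mul_div_cancel₀ _ (by norm_num), Real.exp_log (by linarith)]
  have hlogy : Real.log y = Real.log L / 8 := Real.log_exp _
  have hy1 : 1 ≤ y := Real.one_le_exp (by positivity)
  have hn1 : Real.log ((n : ℝ) + 1) ≤ 2 * (y ^ 4) ^ 2 := by
    rw [← pow_mul, hy8]
    have h : Real.log ((n : ℝ) + 1) ≤ Real.log ((n : ℝ) ^ 2) :=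
      Real.log_le_log (by positivity) (by nlinarith)
    rwa [Real.log_pow] at h
  set m := ⌊y ^ 2⌋₊ + 3
  have hm : 3 ≤ m := by omega
  have hm_le : (m : ℝ) ≤ 4 * y ^ 2 := by
    have := Nat.floor_le (sq_nonneg y)
    have : (m : ℝ) = (⌊y ^ 2⌋₊ : ℝ) + 3 := by simp [m]
    nlinarith
  have hm_ge : y ^ 2 + 2 ≤ m := by
    have := Nat.lt_floor_add_one (y ^ 2)
    have : (m : ℝ) = (⌊y ^ 2⌋₊ : ℝ) + 3 := by simp [m]
    linarith
  have hpath := hst.path_length_le hr hm hv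
  have hdeg_pos : 0 < indeg 0 s (s^[N + 1] v) := by
    rw [iterate_succ_apply']
    exact indeg_step_pos hv
  have hdeg := hst.log_indeg_le hr hdeg_pos (by positivity : 0 ≤ y ^ 4) hn1
  have hy4 : 1 ≤ y ^ 4 := one_le_pow₀ hy1
  have hy46 : y ^ 4 ≤ y ^ 6 := pow_le_pow_right₀ hy1 (by norm_num)
  have t1 : Real.log ((m : ℝ) ^ (2 * m)) ≤ 32 * y ^ 4 := by
    rw [Real.log_pow]
    push_cast
    have h1 : Real.log m ≤ m := Real.log_le_self (by positivity)
    calc 2 * (m : ℝ) * Real.log m ≤ 2 * (4 * y ^ 2) * (4 * y ^ 2) := by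
          gcongr
          exact h1.trans hm_le
      _ = _ := by ring
  have t2 : Real.log ((n : ℝ) + 1) / Real.log ((m : ℝ) / 2) ≤ 16 * (L / Real.log L) := by
    have h1 : Real.log L / 8 ≤ Real.log ((m : ℝ) / 2) := by
      rw [← hlogy]
      refine Real.log_le_log (by positivity) ?_
      nlinarith [sq_nonneg (y - 1)]
    calc _ ≤ (2 * (y ^ 4) ^ 2) / (Real.log L / 8) := by gcongr
      _ = _ := by
        rw [← pow_mul, hy8]
        field_simp
        norm_num
  have t3 : (m : ℝ) * Real.log (indeg 0 s (s^[N + 1] v)) ≤ 24 * y ^ 6 :=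
    calc _ ≤ 4 * y ^ 2 * (6 * y ^ 4) := by
          gcongr
          linarith
      _ = _ := by ring
  have t4 : y ^ 6 ≤ 8 * (L / Real.log L) := by
    rw [mul_div_assoc', le_div_iff₀ hl]
    have h1 : Real.log L ≤ 8 * y := by
      have := Real.log_le_self (by positivity : 0 ≤ y)
      linarith
    have h2 : y ^ 7 ≤ y ^ 8 := pow_le_pow_right₀ hy1 (by norm_num)
    calc y ^ 6 * Real.log L ≤ y ^ 6 * (8 * y) := by gcongr
      _ = 8 * y ^ 7 := by ring
      _ ≤ 8 * L := by linarith
  linarith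

/-- There is a constant `C > 0` such that for every `n ≥ 3` and every
stable tree with `n` agents, the height of the tree (the maximum length of a
leaf-to-root path) is at most `C · (log n / log log n)`. -/
theorem height_upper_bound :
    ∃ C : ℝ, 0 < C ∧
      ∀ n : ℕ, 3 ≤ n → ∀ s : Fin (n + 1) → Fin (n + 1),
        IsStable 0 s → (∀ v, ∃ k, s^[k] v = 0) →
        (height s : ℝ) ≤ C * (Real.log (n : ℝ) / Real.log (Real.log (n : ℝ))) := by
  refine ⟨5000, by norm_num, fun n hn s hst hr => ?_⟩
  rcases Nat.eq_zero_or_pos (height s) with h | h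
  · have hn' : (3 : ℝ) ≤ n := by exact_mod_cast hn
    have hL : 1 < Real.log n := by
      rw [Real.lt_log_iff_exp_lt (by linarith)]
      linarith [Real.exp_one_lt_d9]
    have := Real.log_pos hL
    rw [h, Nat.cast_zero]
    positivity
  · have hnot : height s - 1 ∉ {k | ∀ v, s^[k] v = 0} :=
      Nat.notMem_of_lt_sInf (Nat.sub_lt h one_pos)
    simp only [Set.mem_ofPred_eq, not_forall] at hnot
    obtain ⟨v, hv⟩ := hnot
    have := hst.length_succ_le hn hr hv
    rwa [Nat.cast_sub h, Nat.cast_one, sub_add_cancel] at this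

end TCG
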